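/- Let 𝓛 = {L_1, …, L_k} be a finite collection of infinite subsets of ℕ with closure dimension d, and let ε > 0 and n ∈ ℕ. Then there exists an ε-differentially private mechanism A : (Fin n → ℕ) → PMF(Finset (Fin k)) such that for every i* ∈ {1,…,k} and every injective input x : Fin n → ℕ with range contained in L_{i*}, with probability at least 1 − 4·exp(−ε·(n−d)/(2k)) the sampled set S satisfies both that i* ∈ S (hence ⋂_{i ∈ S} L_i ⊆ L_{i*}) and that ⋂_{i ∈ S} L_i is infinite. -/

import Mathlib

/-- Two finite inputs are neighboring if they differ in exactly one coordinate. -/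
def NeighboringFin {n : ℕ} {α : Type*} (x x' : Fin n → α) : Prop :=
  ∃ j, x j ≠ x' j ∧ ∀ m, m ≠ j → x m = x' m

/-- ε-differential privacy for an algorithm on `n` input strings. -/
def DPFin {n : ℕ} {α Y : Type*} (ε : ℝ) (A : (Fin n → α) → PMF Y) : Prop :=
  ∀ x x' : Fin n → α, NeighboringFin x x' → ∀ E : Set Y,
    (A x).toOuterMeasure E ≤ ENNReal.ofReal (Real.exp ε) * (A x').toOuterMeasure E

/-- The closure of a subcollection: the intersection of its languages
(with `Cl L ∅ = Set.univ`). -/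
def Cl {k : ℕ} (L : Fin k → Set ℕ) (S : Finset (Fin k)) : Set ℕ := ⋂ i ∈ S, L i

/-- `d` bounds the closure dimension: every subcollection has closure that is
either infinite or of cardinality at most `d`. -/
def IsClosureBound {k : ℕ} (L : Fin k → Set ℕ) (d : ℤ) : Prop :=
  ∀ S : Finset (Fin k), (Cl L S).Infinite ∨ ((Cl L S).ncard : ℤ) ≤ d

/-- The closure dimension of the collection `L` is the smallest
`d ∈ {-1} ∪ ℕ` that bounds it. -/
def HasClosureDim {k : ℕ} (L : Fin k → Set ℕ) (d : ℤ) : Prop :=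
  IsClosureBound L d ∧ ∀ d' : ℤ, -1 ≤ d' → IsClosureBound L d' → d ≤ d'

open Classical in
/-- The number of sample points outside the closure of the subcollection `S`. -/
noncomputable def missCount {k n : ℕ} (L : Fin k → Set ℕ) (x : Fin n → ℕ)
    (S : Finset (Fin k)) : ℕ :=
  (Finset.univ.filter fun j => x j ∉ Cl L S).card

open Classical in
/-- The unnormalized weight `l ^ |S| * exp (-(ε / 2) * missCount L x S)` of a subcollection with
infinite closure; all other subcollections get weight zero. -/
noncomputable def closureWeight {k n : ℕ} (L : Fin k → Set ℕ) (ε l : ℝ) (x : Fin n → ℕ)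
    (S : Finset (Fin k)) : ℝ :=
  if (Cl L S).Infinite then l ^ S.card * Real.exp (-(ε / 2) * missCount L x S) else 0

lemma closureWeight_nonneg {k n : ℕ} (L : Fin k → Set ℕ) (ε : ℝ) {l : ℝ} (hl : 0 ≤ l)
    (x : Fin n → ℕ) (S : Finset (Fin k)) : 0 ≤ closureWeight L ε l x S := by
  unfold closureWeight
  split_ifs <;> positivity

lemma NeighboringFin.symm {n : ℕ} {α : Type*} {x x' : Fin n → α} (h : NeighboringFin x x') :
    NeighboringFin x' x := by
  obtain ⟨j, hj, h⟩ := h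
  exact ⟨j, hj.symm, fun m hm => (h m hm).symm⟩

lemma missCount_le_succ {k n : ℕ} (L : Fin k → Set ℕ) {x x' : Fin n → ℕ}
    (h : NeighboringFin x x') (S : Finset (Fin k)) :
    missCount L x' S ≤ missCount L x S + 1 := by
  classical
  obtain ⟨j, -, h⟩ := h
  unfold missCount
  refine le_trans (Finset.card_le_card ?_) (Finset.card_insert_le j _)
  intro m hm
  by_cases hmj : m = j
  · simp [hmj]
  · simp only [Finset.mem_insert, Finset.mem_filter, Finset.mem_univ, true_and] at hm ⊢
    exact Or.inr (by rwa [h m hmj])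

lemma closureWeight_le_of_neighboring {k n : ℕ} (L : Fin k → Set ℕ) {ε l : ℝ} (hε : 0 ≤ ε)
    (hl : 0 ≤ l) {x x' : Fin n → ℕ} (h : NeighboringFin x x') (S : Finset (Fin k)) :
    closureWeight L ε l x S ≤ Real.exp (ε / 2) * closureWeight L ε l x' S := by
  unfold closureWeight
  split_ifs
  · rw [mul_left_comm, ← Real.exp_add]
    refine mul_le_mul_of_nonneg_left (Real.exp_le_exp.mpr ?_) (by positivity)
    have : (missCount L x' S : ℝ) ≤ missCount L x S + 1 := by
      exact_mod_cast missCount_le_succ L h S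
    nlinarith
  · simp

/-- The probability mass function proportional to a weight of positive total mass. -/
noncomputable def PMF.ofWeight {Y : Type*} [Fintype Y] (w : Y → ℝ) (hw : ∀ y, 0 ≤ w y)
    (hpos : 0 < ∑ y, w y) : PMF Y :=
  PMF.ofFintype (fun y => ENNReal.ofReal (w y / ∑ z, w z)) (by
    rw [← ENNReal.ofReal_sum_of_nonneg fun y _ => div_nonneg (hw y) hpos.le, ← Finset.sum_div,
      div_self hpos.ne', ENNReal.ofReal_one])

/-- A mechanism sampling proportionally to weights that change by a factor of at most
`exp (ε / 2)` between neighboring inputs is `ε`-differentially private. -/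
lemma dpFin_ofWeight {n : ℕ} {α Y : Type*} [Fintype Y] {ε : ℝ} (w : (Fin n → α) → Y → ℝ)
    (hw : ∀ x y, 0 ≤ w x y) (hpos : ∀ x, 0 < ∑ y, w x y)
    (h : ∀ x x', NeighboringFin x x' → ∀ y, w x y ≤ Real.exp (ε / 2) * w x' y) :
    DPFin ε fun x => PMF.ofWeight (w x) (hw x) (hpos x) := by
  intro x x' hx E
  simp only [PMF.toOuterMeasure_apply_fintype, Finset.mul_sum]
  refine Finset.sum_le_sum fun y _ => ?_
  by_cases hy : y ∈ E
  · simp only [Set.indicator_of_mem hy, PMF.ofWeight, PMF.ofFintype_apply]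
    rw [← ENNReal.ofReal_mul (Real.exp_pos ε).le]
    refine ENNReal.ofReal_le_ofReal ?_
    have hZ : ∑ z, w x' z ≤ Real.exp (ε / 2) * ∑ z, w x z := by
      rw [Finset.mul_sum]
      exact Finset.sum_le_sum fun z _ => h x' x hx.symm z
    rw [← mul_div_assoc, div_le_div_iff₀ (hpos x) (hpos x')]
    calc w x y * ∑ z, w x' z
        ≤ (Real.exp (ε / 2) * w x' y) * (Real.exp (ε / 2) * ∑ z, w x z) :=
          mul_le_mul (h x x' hx y) hZ (hpos x').le
            (mul_nonneg (Real.exp_pos _).le (hw x' y))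
      _ = Real.exp ε * w x' y * ∑ z, w x z := by
          rw [show ε = ε / 2 + ε / 2 by ring, Real.exp_add]
          ring_nf
  · simp [Set.indicator_of_notMem hy]

lemma Cl_empty {k : ℕ} (L : Fin k → Set ℕ) : Cl L ∅ = Set.univ := by simp [Cl]

lemma Cl_insert {k : ℕ} (L : Fin k → Set ℕ) (i : Fin k) (S : Finset (Fin k)) :
    Cl L (insert i S) = L i ∩ Cl L S := by simp [Cl]

lemma closureWeight_empty {k n : ℕ} (L : Fin k → Set ℕ) (ε l : ℝ) (x : Fin n → ℕ) :
    closureWeight L ε l x ∅ = 1 := by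
  simp [closureWeight, missCount, Cl_empty, Set.infinite_univ]

lemma one_le_sum_closureWeight {k n : ℕ} (L : Fin k → Set ℕ) (ε : ℝ) {l : ℝ} (hl : 0 ≤ l)
    (x : Fin n → ℕ) : 1 ≤ ∑ S, closureWeight L ε l x S := by
  rw [← closureWeight_empty L ε l x]
  exact Finset.single_le_sum (fun S _ => closureWeight_nonneg L ε hl x S) (Finset.mem_univ ∅)

lemma missCount_insert {k n : ℕ} (L : Fin k → Set ℕ) {x : Fin n → ℕ} {i : Fin k}
    (hx : Set.range x ⊆ L i) (S : Finset (Fin k)) :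
    missCount L x (insert i S) = missCount L x S := by
  have h : ∀ j, x j ∈ L i := fun j => hx ⟨j, rfl⟩
  refine congrArg Finset.card (Finset.ext fun j => ?_)
  simp only [Finset.mem_filter, Finset.mem_univ, true_and, Cl_insert, Set.mem_inter_iff, h]

lemma le_missCount_add {k n : ℕ} {L : Fin k → Set ℕ} {d : ℕ} (hd : IsClosureBound L d)
    {x : Fin n → ℕ} (hinj : Function.Injective x) {S : Finset (Fin k)}
    (hS : ¬ (Cl L S).Infinite) : n ≤ missCount L x S + d := by
  classical
  have hcard : (Cl L S).ncard ≤ d := by exact_mod_cast (hd S).resolve_left hS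
  have hin : (Finset.univ.filter fun j => x j ∈ Cl L S).card ≤ d := by
    refine le_trans ?_ hcard
    rw [← Finset.card_image_of_injective _ hinj, ← Set.ncard_coe_finset]
    refine Set.ncard_le_ncard ?_ (Set.not_infinite.mp hS)
    intro y hy
    simp only [Finset.coe_image, Finset.coe_filter, Finset.mem_univ, true_and] at hy
    obtain ⟨j, hj, rfl⟩ := hy
    exact hj
  have hsum := Finset.card_filter_add_card_filter_not (s := (Finset.univ : Finset (Fin n)))
    (fun j => x j ∈ Cl L S)
  simp only [Finset.card_univ, Fintype.card_fin] at hsum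
  have hm : missCount L x S = (Finset.univ.filter fun j => x j ∉ Cl L S).card := by
    unfold missCount
    congr
  omega

lemma mul_closureWeight_le {k n : ℕ} {L : Fin k → Set ℕ} {d : ℕ} (hd : IsClosureBound L d)
    {ε l : ℝ} (hε : 0 ≤ ε) (hl : 0 ≤ l) {x : Fin n → ℕ} (hinj : Function.Injective x)
    {i : Fin k} (hx : Set.range x ⊆ L i) {S : Finset (Fin k)} (hi : i ∉ S) :
    l * closureWeight L ε l x S ≤ closureWeight L ε l x (insert i S) +
      l * (l ^ S.card * Real.exp (-(ε / 2) * ((n : ℝ) - d))) := by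
  by_cases h : (Cl L (insert i S)).Infinite
  · have hS : (Cl L S).Infinite := by
      rw [Cl_insert] at h
      exact h.mono Set.inter_subset_right
    have : 0 ≤ l * (l ^ S.card * Real.exp (-(ε / 2) * ((n : ℝ) - d))) := by positivity
    simp only [closureWeight, if_pos h, if_pos hS, missCount_insert L hx,
      Finset.card_insert_of_notMem hi, pow_succ]
    linarith
  · have hm : (n : ℝ) ≤ missCount L x S + d := by
      have := le_missCount_add hd hinj h
      rw [missCount_insert L hx] at this
      exact_mod_cast this
    have hle : closureWeight L ε l x S ≤
        l ^ S.card * Real.exp (-(ε / 2) * ((n : ℝ) - d)) := by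
      unfold closureWeight
      split_ifs
      · refine mul_le_mul_of_nonneg_left (Real.exp_le_exp.mpr ?_) (by positivity)
        nlinarith
      · positivity
    have h0 := closureWeight_nonneg L ε hl x (insert i S)
    have := mul_le_mul_of_nonneg_left hle hl
    linarith

/-- If the input consists of distinct points of `L i`, the subcollections not containing `i`
carry at most a `2 * exp (-a)` fraction of the total weight, where `2 * k * a = ε * (n - d)`. -/
lemma sum_closureWeight_insert_ge {k n : ℕ} {L : Fin k → Set ℕ} {d : ℕ}
    (hd : IsClosureBound L d) {ε a : ℝ} (hε : 0 ≤ ε) (ha : 0 ≤ a)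
    (hak : 2 * k * a = ε * ((n : ℝ) - d)) {x : Fin n → ℕ} (hinj : Function.Injective x)
    {i : Fin k} (hx : Set.range x ⊆ L i) :
    (1 - 2 * Real.exp (-a)) * ∑ S, closureWeight L ε (Real.exp a - 1) x S ≤
      ∑ S ∈ (Finset.univ.erase i).powerset,
        closureWeight L ε (Real.exp a - 1) x (insert i S) := by
  set l : ℝ := Real.exp a - 1 with hl_def
  have hl : 0 ≤ l := by
    have := Real.one_le_exp ha
    linarith
  set P := (Finset.univ.erase i).powerset with hP
  set W := closureWeight L ε l x with hW
  have htotal : ∑ S, W S = ∑ S ∈ P, W S + ∑ S ∈ P, W (insert i S) := by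
    rw [hP, ← Finset.sum_powerset_insert (Finset.notMem_erase i _),
      Finset.insert_erase (Finset.mem_univ i), Finset.powerset_univ]
  have hpow : ∑ S ∈ P, l ^ S.card = Real.exp (a * (k - 1)) := by
    have h := Finset.sum_pow_mul_eq_add_pow l 1 (Finset.univ.erase i)
    simp only [one_pow, mul_one, Finset.card_erase_of_mem (Finset.mem_univ i),
      Finset.card_univ, Fintype.card_fin] at h
    have hk : 1 ≤ k := i.pos
    rw [h, hl_def, sub_add_cancel, ← Real.exp_nat_mul, Nat.cast_sub hk, Nat.cast_one, mul_comm]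
  have hsum : l * ∑ S ∈ P, W S ≤ ∑ S ∈ P, W (insert i S) + l * Real.exp (-a) := by
    calc l * ∑ S ∈ P, W S
        ≤ ∑ S ∈ P, (W (insert i S) +
            l * (l ^ S.card * Real.exp (-(ε / 2) * ((n : ℝ) - d)))) := by
          rw [Finset.mul_sum]
          refine Finset.sum_le_sum fun S hS => mul_closureWeight_le hd hε hl hinj hx ?_
          intro hi
          exact Finset.notMem_erase i _ (Finset.mem_powerset.mp hS hi)
      _ = ∑ S ∈ P, W (insert i S) + l * Real.exp (-a) := by
          rw [Finset.sum_add_distrib, ← Finset.mul_sum, ← Finset.sum_mul, hpow, ← Real.exp_add]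
          congr 3
          linarith
  have hone : 1 ≤ ∑ S, W S := one_le_sum_closureWeight L ε hl x
  have hexp : Real.exp a * Real.exp (-a) = 1 := by rw [← Real.exp_add]; simp
  have hneg := Real.exp_pos (-a)
  have hbound : Real.exp a * ∑ S ∈ P, W S ≤ 2 * ∑ S, W S := by
    have : l * Real.exp (-a) ≤ 1 := by rw [hl_def]; nlinarith
    have : Real.exp a * ∑ S ∈ P, W S = l * ∑ S ∈ P, W S + ∑ S ∈ P, W S := by rw [hl_def]; ring
    linarith
  have hbad : ∑ S ∈ P, W S ≤ 2 * Real.exp (-a) * ∑ S, W S := by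
    have h := mul_le_mul_of_nonneg_left hbound hneg.le
    rw [← mul_assoc, mul_comm (Real.exp (-a)), hexp] at h
    linarith
  linarith

/-- For a finite collection of `k` infinite languages of closure
dimension `d`, there is an ε-DP mechanism on `n` inputs sampling a subset
`S ⊆ {1,…,k}` such that, whenever the input consists of distinct elements of a
target language `L_{i*}`, with probability at least `1 − 4·exp(−ε(n−d)/(2k))`
the sampled `S` contains `i*` (hence `⋂_{i ∈ S} L_i ⊆ L_{i*}`) and
`⋂_{i ∈ S} L_i` is infinite. -/
theorem stmt19 (k : ℕ) (hk : 0 < k) (L : Fin k → Set ℕ)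
    (hL : ∀ i, (L i).Infinite) (d : ℕ) (hdim : HasClosureDim L (d : ℤ))
    (ε : ℝ) (hε : 0 < ε) (n : ℕ) :
    ∃ A : (Fin n → ℕ) → PMF (Finset (Fin k)), DPFin ε A ∧
      ∀ istar : Fin k, ∀ x : Fin n → ℕ, Function.Injective x →
        Set.range x ⊆ L istar →
        ENNReal.ofReal (1 - 4 * Real.exp (-(ε * ((n : ℝ) - (d : ℝ))) / (2 * k))) ≤
          (A x).toOuterMeasure {S | istar ∈ S ∧ (Cl L S).Infinite} := by
  by_cases hnd : (n : ℝ) - d ≤ 0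
  · refine ⟨fun _ => PMF.pure ∅, ?_, ?_⟩
    · intro x x' _ E
      exact le_mul_of_one_le_left (zero_le)
        (ENNReal.one_le_ofReal.mpr (Real.one_le_exp hε.le))
    · intro i x _ _
      have h : 1 ≤ Real.exp (-(ε * ((n : ℝ) - (d : ℝ))) / (2 * k)) :=
        Real.one_le_exp (div_nonneg (by nlinarith) (by positivity))
      rw [ENNReal.ofReal_of_nonpos (by linarith)]
      exact zero_le
  have hk' : (0 : ℝ) < k := by exact_mod_cast hk
  set a : ℝ := ε * ((n : ℝ) - d) / (2 * k) with ha_def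
  have ha : 0 ≤ a := div_nonneg (mul_nonneg hε.le (by linarith)) (by positivity)
  have hak : 2 * k * a = ε * ((n : ℝ) - d) := by rw [ha_def]; field_simp
  have hl : 0 ≤ Real.exp a - 1 := by
    have := Real.one_le_exp ha
    linarith
  have hw := closureWeight_nonneg (n := n) L ε hl
  have hpos : ∀ x : Fin n → ℕ, 0 < ∑ S, closureWeight L ε (Real.exp a - 1) x S := fun x =>
    zero_lt_one.trans_le (one_le_sum_closureWeight L ε hl x)
  refine ⟨fun x => PMF.ofWeight _ (hw x) (hpos x), dpFin_ofWeight _ hw hpos fun x x' h =>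
    closureWeight_le_of_neighboring L hε.le hl h, ?_⟩
  intro i x hinj hx
  have hgood := sum_closureWeight_insert_ge hdim.1 hε.le ha hak hinj hx
  rw [neg_div, ← ha_def, PMF.toOuterMeasure_apply_fintype]
  set W := closureWeight L ε (Real.exp a - 1) x with hW
  set Z := ∑ S, W S with hZ
  have hZpos : 0 < Z := hpos x
  have hinsert : Set.InjOn (insert i) ((Finset.univ.erase i).powerset : Set (Finset (Fin k))) := by
    intro S hS T hT hST
    have hiS : i ∉ S := fun h => Finset.notMem_erase i _ (Finset.mem_powerset.mp hS h)
    have hiT : i ∉ T := fun h => Finset.notMem_erase i _ (Finset.mem_powerset.mp hT h)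
    rw [← Finset.erase_insert hiS, ← Finset.erase_insert hiT]
    exact congrArg (fun U => U.erase i) hST
  calc ENNReal.ofReal (1 - 4 * Real.exp (-a))
      ≤ ENNReal.ofReal (∑ S ∈ (Finset.univ.erase i).powerset, W (insert i S) / Z) := by
        refine ENNReal.ofReal_le_ofReal ?_
        rw [← Finset.sum_div, le_div_iff₀ hZpos]
        refine le_trans (mul_le_mul_of_nonneg_right ?_ hZpos.le) hgood
        have := Real.exp_pos (-a)
        linarith
    _ = ∑ S ∈ (Finset.univ.erase i).powerset.image (insert i), ENNReal.ofReal (W S / Z) := by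
        rw [ENNReal.ofReal_sum_of_nonneg fun S _ => div_nonneg (hw x _) hZpos.le,
          Finset.sum_image hinsert]
    _ ≤ ∑ S ∈ (Finset.univ.erase i).powerset.image (insert i),
          Set.indicator {S | i ∈ S ∧ (Cl L S).Infinite}
            (PMF.ofWeight W (hw x) (hpos x)) S := by
        refine Finset.sum_le_sum fun S hS => ?_
        obtain ⟨T, -, rfl⟩ := Finset.mem_image.mp hS
        by_cases hinf : (Cl L (insert i T)).Infinite
        · rw [Set.indicator_of_mem (show insert i T ∈ {S | i ∈ S ∧ (Cl L S).Infinite} from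
            ⟨Finset.mem_insert_self i T, hinf⟩)]
          simp [PMF.ofWeight, hZ]
        · simp [hW, closureWeight, hinf]
    _ ≤ _ := Finset.sum_le_sum_of_subset (Finset.subset_univ _)
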